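/- arXiv:1504.02403 — 3 statements merged into one kernel-verified Lean document; each statement's English description precedes it below -/
import Mathlib

section
/- R(5,10) ≥ 149; that is, there exists a 2-coloring of the edges of the complete graph K_148 containing no monochromatic K_5 in color 1 and no monochromatic K_10 in color 2. -/
/-- Left division `a⁻¹ * b` in the dihedral group of order 148, whose rotation by `i` is encoded as
`2 * i` and whose reflections are encoded as the odd numbers below 148. -/
def leftDiv (a b : ℕ) : ℕ :=
  if a % 2 = 0 then (b + 148 - a) % 148 else (a + 148 - b) % 148

/-- `s` is a clique of the Cayley graph on the dihedral group of order 148 whose connection set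
consists of the binary digits `1` of `C`. -/
def IsCayleyClique (C : ℕ) (s : Finset ℕ) : Prop :=
  (∀ a ∈ s, a < 148) ∧ ∀ a ∈ s, ∀ b ∈ s, a ≠ b → C.testBit (leftDiv a b)

theorem leftDiv_lt (a b : ℕ) : leftDiv a b < 148 := by
  unfold leftDiv; split <;> omega

theorem leftDiv_self {a : ℕ} : leftDiv a a = 0 := by
  unfold leftDiv; split <;> omega

theorem leftDiv_zero_left {b : ℕ} (hb : b < 148) : leftDiv 0 b = b := by
  unfold leftDiv; simp; omega

theorem leftDiv_leftDiv {u a b : ℕ} (hu : u < 148) (ha : a < 148) (hb : b < 148) :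
    leftDiv (leftDiv u a) (leftDiv u b) = leftDiv a b := by
  unfold leftDiv; split_ifs <;> omega

theorem leftDiv_right_injective {u a b : ℕ} (hu : u < 148) (ha : a < 148) (hb : b < 148)
    (h : leftDiv u a = leftDiv u b) : a = b := by
  unfold leftDiv at h; split_ifs at h <;> omega

theorem leftDiv_swap {a b t : ℕ} (ht : t % 2 = 0) (ht0 : 0 < t) (ht' : t < 148)
    (ha : a < 148) (hb : b < 148) (h : leftDiv a b = 148 - t) : leftDiv b a = t := by
  unfold leftDiv at *; split_ifs at * <;> omega

theorem IsCayleyClique.image_leftDiv {C : ℕ} {s : Finset ℕ} (hs : IsCayleyClique C s) {u : ℕ}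
    (hu : u < 148) : IsCayleyClique C (s.image (leftDiv u)) := by
  refine ⟨fun a ha => ?_, fun a ha b hb hab => ?_⟩
  · obtain ⟨x, -, rfl⟩ := Finset.mem_image.1 ha
    exact leftDiv_lt _ _
  · obtain ⟨x, hx, rfl⟩ := Finset.mem_image.1 ha
    obtain ⟨y, hy, rfl⟩ := Finset.mem_image.1 hb
    rw [leftDiv_leftDiv hu (hs.1 x hx) (hs.1 y hy)]
    exact hs.2 x hx y hy fun h => hab (h ▸ rfl)

theorem IsCayleyClique.card_image_leftDiv {C : ℕ} {s : Finset ℕ} (hs : IsCayleyClique C s) {u : ℕ}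
    (hu : u < 148) : (s.image (leftDiv u)).card = s.card :=
  Finset.card_image_of_injOn fun a ha b hb h =>
    leftDiv_right_injective hu (hs.1 a ha) (hs.1 b hb) h

/-- Remove the digits `t` and `148 - t` from `C`. -/
def eraseRotation (C t : ℕ) : ℕ :=
  Nat.xor C (Nat.land C (Nat.lor (Nat.pow 2 t) (Nat.pow 2 (Nat.sub 148 t))))

theorem testBit_eraseRotation {C t x : ℕ} (hx : C.testBit x) (h : x ≠ t) (h' : x ≠ 148 - t) :
    (eraseRotation C t).testBit x := by
  change (C ^^^ (C &&& (2 ^ t ||| 2 ^ (148 - t)))).testBit x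
  simp [hx, h.symm, h'.symm]

theorem IsCayleyClique.eraseRotation {C t : ℕ} {s : Finset ℕ} (hs : IsCayleyClique C s)
    (ht : t % 2 = 0) (ht0 : 0 < t) (ht' : t < 148)
    (h : ∀ s', IsCayleyClique C s' → 0 ∈ s' → t ∈ s' → s'.card ≠ s.card) :
    IsCayleyClique (eraseRotation C t) s := by
  have key : ∀ a ∈ s, ∀ b ∈ s, leftDiv a b ≠ t := fun a ha b hb hab =>
    h _ (hs.image_leftDiv (hs.1 a ha)) (Finset.mem_image.2 ⟨a, ha, leftDiv_self⟩)
      (Finset.mem_image.2 ⟨b, hb, hab⟩) (hs.card_image_leftDiv (hs.1 a ha))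
  exact ⟨hs.1, fun a ha b hb hab => testBit_eraseRotation (hs.2 a ha b hb hab) (key a ha b hb)
    fun h => key b hb a ha (leftDiv_swap ht ht0 ht' (hs.1 a ha) (hs.1 b hb) h)⟩

/-- The number whose binary digits below `n` are those of `C` in reverse order. -/
def reverseBits (C : ℕ) : ℕ → ℕ
  | 0 => 0
  | n + 1 => Nat.lor (Nat.mul 2 (reverseBits C n)) (Nat.land (Nat.shiftRight C n) 1)

theorem testBit_reverseBits (C : ℕ) {n i : ℕ} (hi : i < n) :
    (reverseBits C n).testBit i = C.testBit (n - 1 - i) := by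
  induction n generalizing i with
  | zero => omega
  | succ n ih =>
    change (2 * reverseBits C n ||| (C >>> n &&& 1)).testBit i = _
    cases i with
    | zero => simp
    | succ i =>
      rw [Nat.testBit_lor, Nat.and_one_is_mod, Nat.testBit_succ, Nat.testBit_succ,
        Nat.mul_div_cancel_left _ two_pos, ih (by omega),
        Nat.div_eq_of_lt (Nat.mod_lt _ two_pos), Nat.zero_testBit, Bool.or_false]
      congr 1
      omega

/-- Two periods of the digits of `C`, of period 148. -/
def double (C : ℕ) : ℕ := Nat.lor C (Nat.shiftLeft C 148)

theorem testBit_double {C x : ℕ} (hx : x < 296) (h : C.testBit (x % 148)) :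
    (double C).testBit x := by
  change (C ||| C <<< 148).testBit x
  rw [Nat.testBit_lor, Nat.testBit_shiftLeft]
  rcases Nat.lt_or_ge x 148 with hlt | hge
  · rw [Nat.mod_eq_of_lt hlt] at h
    simp [h]
  · rw [show x % 148 = x - 148 by omega] at h
    simp [h, hge]

/-- The neighbours of `v`, when `M` and `N` are the doubled connection set and its reversal. -/
def neighbors (M N v : ℕ) : ℕ :=
  Nat.shiftRight (bif Nat.beq (Nat.mod v 2) 0 then M else N) (Nat.sub 148 v)

theorem testBit_neighbors {C a b : ℕ} (ha : a < 148) (hb : b < 148)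
    (h : C.testBit (leftDiv a b)) :
    (neighbors (double C) (reverseBits (double C) 297) a).testBit b := by
  change (((bif Nat.beq (a % 2) 0 then _ else _) : ℕ) >>> (148 - a)).testBit b = true
  rw [Nat.testBit_shiftRight]
  unfold leftDiv at h
  split_ifs at h with hpar
  · simp only [hpar, Nat.beq_refl, cond_true]
    exact testBit_double (by omega) (by rwa [show 148 - a + b = b + 148 - a by omega])
  · have : Nat.beq (a % 2) 0 = false := by rw [Nat.mod_two_ne_zero.1 hpar]; rfl
    rw [this, cond_false, testBit_reverseBits _ (by omega)]
    refine testBit_double (by omega) ?_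
    rwa [show 297 - 1 - (148 - a + b) = a + 148 - b by omega]

/-- Exhaustive search confirming that the set of binary digits `1` of `P` contains no `k`-clique,
branching on the largest element. The recursor is used for the sake of kernel evaluation. -/
noncomputable def noClique (M N fuel : ℕ) : ℕ → ℕ → Bool :=
  Nat.rec (fun _ _ => false) (fun _ ih k P =>
    Nat.rec false (fun k' _ => Nat.rec true (fun p _ =>
      and
        (ih k' (Nat.land (Nat.xor (Nat.succ p) (Nat.pow 2 (Nat.log2 (Nat.succ p))))
          (neighbors M N (Nat.log2 (Nat.succ p)))))
        (ih (Nat.succ k') (Nat.xor (Nat.succ p) (Nat.pow 2 (Nat.log2 (Nat.succ p)))))) P) k) fuel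

theorem noClique_sound {M N fuel k P : ℕ} (h : noClique M N fuel k P = true) {s : Finset ℕ}
    (hP : ∀ a ∈ s, P.testBit a)
    (hs : ∀ a ∈ s, ∀ b ∈ s, a ≠ b → (neighbors M N a).testBit b) : s.card ≠ k := by
  induction fuel generalizing k P s with
  | zero => exact absurd h Bool.false_ne_true
  | succ fuel ih =>
    cases k with
    | zero => exact absurd h Bool.false_ne_true
    | succ k =>
      cases P with
      | zero =>
        have : s = ∅ := Finset.eq_empty_of_forall_notMem fun a ha => by simpa using hP a ha
        simp [this]
      | succ p =>
        set v := Nat.log2 (p + 1) with hv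
        have h : (noClique M N fuel k (((p + 1) ^^^ 2 ^ v) &&& neighbors M N v) &&
          noClique M N fuel (k + 1) ((p + 1) ^^^ 2 ^ v)) = true := h
        rw [Bool.and_eq_true] at h
        have hQ : ∀ a ∈ s, a ≠ v → ((p + 1) ^^^ 2 ^ v).testBit a := fun a ha hav => by
          rw [Nat.testBit_xor, hP a ha, Nat.testBit_two_pow_of_ne hav.symm]
          rfl
        by_cases hvs : v ∈ s
        · have hc := ih (s := s.erase v) h.1
            (fun a ha => by
              rw [Finset.mem_erase] at ha
              rw [Nat.testBit_land, hQ a ha.2 ha.1, hs v hvs a ha.2 ha.1.symm]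
              rfl)
            (fun a ha b hb => hs a (Finset.mem_of_mem_erase ha) b (Finset.mem_of_mem_erase hb))
          rw [Finset.card_erase_of_mem hvs] at hc
          omega
        · exact ih h.2 (fun a ha => hQ a ha fun hav => hvs (hav ▸ ha)) hs

/-- Call-by-value application, which makes the kernel evaluate `n` before substituting it. -/
noncomputable def force (n : ℕ) (f : ℕ → Bool) : Bool :=
  Nat.rec (f 0) (fun m _ => f (Nat.succ m)) n

theorem force_eq (n : ℕ) (f : ℕ → Bool) : force n f = f n := by
  cases n <;> rfl

/-- Confirm that there is no `n`-clique in the Cayley graph with connection set `C`: for each `t`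
in `l`, exclude the cliques containing `0` and `t`, and then remove `t` from the connection set. -/
noncomputable def noCayleyClique (n : ℕ) (l : List ℕ) : ℕ → Bool :=
  List.rec
    (fun C => force (double C) fun M => force (reverseBits M 297) fun N =>
      noClique M N 149 (Nat.sub n 1) C)
    (fun t _ ih C => and
      (force (double C) fun M => force (reverseBits M 297) fun N =>
        noClique M N 149 (Nat.sub n 2) (Nat.land C (neighbors M N t)))
      (force (eraseRotation C t) ih)) l

theorem noCayleyClique_nil (n C : ℕ) : noCayleyClique n [] C =
    noClique (double C) (reverseBits (double C) 297) 149 (n - 1) C := by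
  change (force (double C) fun M => force (reverseBits M 297) fun N =>
    noClique M N 149 (n - 1) C) = _
  rw [force_eq, force_eq]

theorem noCayleyClique_cons (n t C : ℕ) (l : List ℕ) : noCayleyClique n (t :: l) C =
    (noClique (double C) (reverseBits (double C) 297) 149 (n - 2)
      (C &&& neighbors (double C) (reverseBits (double C) 297) t) &&
      noCayleyClique n l (eraseRotation C t)) := by
  change ((force (double C) fun M => force (reverseBits M 297) fun N =>
    noClique M N 149 (n - 2) (C &&& neighbors M N t)) &&
      force (eraseRotation C t) (noCayleyClique n l)) = _
  rw [force_eq, force_eq, force_eq]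

theorem noCayleyClique_sound {n C : ℕ} {l : List ℕ} (hn : 2 ≤ n)
    (hl : ∀ t ∈ l, t % 2 = 0 ∧ 0 < t ∧ t < 148) (h : noCayleyClique n l C = true)
    {s : Finset ℕ} (hs : IsCayleyClique C s) : s.card ≠ n := by
  have mem_neighbors {C : ℕ} {s : Finset ℕ} (hs : IsCayleyClique C s) :
      ∀ a ∈ s, ∀ b ∈ s, a ≠ b →
        (neighbors (double C) (reverseBits (double C) 297) a).testBit b :=
    fun a ha b hb hab => testBit_neighbors (hs.1 a ha) (hs.1 b hb) (hs.2 a ha b hb hab)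
  have mem_connectionSet {C : ℕ} {s : Finset ℕ} (hs : IsCayleyClique C s) (h0 : 0 ∈ s) :
      ∀ b ∈ s, b ≠ 0 → C.testBit b := fun b hb hb0 => by
    simpa [leftDiv_zero_left (hs.1 b hb)] using hs.2 0 h0 b hb hb0.symm
  induction l generalizing C s with
  | nil =>
    rintro hcard
    obtain ⟨u, hu⟩ : s.Nonempty := Finset.card_pos.1 (by omega)
    have hu' := hs.1 u hu
    have hs' := hs.image_leftDiv hu'
    have h0 : 0 ∈ s.image (leftDiv u) := Finset.mem_image.2 ⟨u, hu, leftDiv_self⟩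
    rw [noCayleyClique_nil] at h
    refine noClique_sound h (s := (s.image (leftDiv u)).erase 0)
      (fun a ha => ?_) (fun a ha b hb => ?_) ?_
    · rw [Finset.mem_erase] at ha
      exact mem_connectionSet hs' h0 a ha.2 ha.1
    · exact mem_neighbors hs' a (Finset.mem_of_mem_erase ha) b (Finset.mem_of_mem_erase hb)
    · rw [Finset.card_erase_of_mem h0, hs.card_image_leftDiv hu', hcard]
  | cons t l ih =>
    obtain ⟨ht, ht0, ht'⟩ := hl t List.mem_cons_self
    rw [noCayleyClique_cons, Bool.and_eq_true] at h
    rintro rfl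
    refine ih (fun t ht => hl t (List.mem_cons_of_mem _ ht)) h.2
      (hs.eraseRotation ht ht0 ht' fun s' hs' h0 hts hcard => ?_) rfl
    refine noClique_sound h.1 (s := (s'.erase 0).erase t)
      (fun a ha => ?_) (fun a ha b hb => ?_) ?_
    · simp only [Finset.mem_erase] at ha
      rw [Nat.testBit_and, mem_connectionSet hs' h0 a ha.2.2 ha.2.1,
        mem_neighbors hs' t hts a ha.2.2 ha.1.symm]
      rfl
    · simp only [Finset.mem_erase] at ha hb
      exact mem_neighbors hs' a ha.2.2 b hb.2.2
    · rw [Finset.card_erase_of_mem (Finset.mem_erase.2 ⟨ht0.ne', hts⟩),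
        Finset.card_erase_of_mem h0, hcard, Nat.sub_sub]

/-- The connection set of a Cayley graph without `K₅`. -/
def connectionSet : ℕ := 33895999340691494330169470886339665580473368

/-- The connection set of the complement. -/
def coconnectionSet : ℕ := 322915923835798475934402021476034118515213286

set_option maxRecDepth 10000 in
theorem noCayleyClique_connectionSet : noCayleyClique 5 [] connectionSet = true := by
  decide +kernel

set_option maxRecDepth 10000 in
theorem noCayleyClique_coconnectionSet :
    noCayleyClique 10
      [2, 6, 8, 14, 18, 24, 26, 30, 32, 36, 38, 40, 44, 48, 50, 56, 58, 60, 62, 64, 68, 70, 72]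
      coconnectionSet = true := by
  decide +kernel

theorem testBit_connectionSet_leftDiv_comm (a b : Fin 148) :
    connectionSet.testBit (leftDiv a b) = connectionSet.testBit (leftDiv b a) := by
  revert a b
  decide +kernel

theorem testBit_coconnectionSet {x : ℕ} (hx : x < 148) (h0 : x ≠ 0)
    (h : ¬ connectionSet.testBit x) : coconnectionSet.testBit x := by
  revert x
  decide +kernel

/-- The Cayley graph on the dihedral group of order 148 with connection set `connectionSet`. -/
def cayleyGraph : SimpleGraph (Fin 148) where
  Adj a b := connectionSet.testBit (leftDiv a b)
  symm := ⟨fun a b h => testBit_connectionSet_leftDiv_comm a b ▸ h⟩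
  loopless := ⟨fun a h => by rw [leftDiv_self] at h; exact absurd h (by decide)⟩

theorem isCayleyClique_map_val {C : ℕ} {s : Finset (Fin 148)}
    (hs : ∀ a ∈ s, ∀ b ∈ s, a ≠ b → C.testBit (leftDiv a b)) :
    IsCayleyClique C (s.map Fin.valEmbedding) := by
  refine ⟨fun a ha => ?_, fun a ha b hb hab => ?_⟩
  · obtain ⟨x, -, rfl⟩ := Finset.mem_map.1 ha
    exact x.2
  · obtain ⟨x, hx, rfl⟩ := Finset.mem_map.1 ha
    obtain ⟨y, hy, rfl⟩ := Finset.mem_map.1 hb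
    exact hs x hx y hy fun h => hab (h ▸ rfl)

theorem cayleyGraph_cliqueFree : cayleyGraph.CliqueFree 5 := fun s hs =>
  noCayleyClique_sound (by decide) (by decide) noCayleyClique_connectionSet
    (isCayleyClique_map_val fun _ ha _ hb hab => hs.1 ha hb hab)
    ((Finset.card_map _).trans hs.2)

theorem compl_cayleyGraph_cliqueFree : cayleyGraphᶜ.CliqueFree 10 := fun s hs =>
  noCayleyClique_sound (by decide) (by decide) noCayleyClique_coconnectionSet
    (isCayleyClique_map_val fun a ha b hb hab =>
      testBit_coconnectionSet (leftDiv_lt a b)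
        (fun h => hab (Fin.ext (leftDiv_right_injective a.2 a.2 b.2 (leftDiv_self.trans h.symm))))
        (hs.1 ha hb hab).2)
    ((Finset.card_map _).trans hs.2)

theorem ramsey_lower_bound_R_5_10 :
    ∃ G : SimpleGraph (Fin 148), G.CliqueFree 5 ∧ Gᶜ.CliqueFree 10 := by
  exact ⟨cayleyGraph, cayleyGraph_cliqueFree, compl_cayleyGraph_cliqueFree⟩
end

section
/- R(5,14) ≥ 242; that is, there exists a 2-coloring of the edges of the complete graph K_241 containing no monochromatic K_5 in color 1 and no monochromatic K_14 in color 2. -/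
/-!
A circulant graph on `ZMod 266` whose connection set is a union of orbits of the group of
multipliers `{±1, ±39, ±191}` is shown to have no `5`-clique and no independent `14`-set; the
required graph on `241` vertices is an induced subgraph of it. Cliques are excluded by a
branch-and-bound search, with greedy colourings as bounds, on sets of naturals encoded as the
bits of a natural number. The search is written with recursors and with the accelerated
operations on `ℕ`, so that the kernel evaluates it quickly.
-/

namespace CirculantRamsey

/-! ### Branch-and-bound search for cliques -/

/-- `z` if `x = 0` and `f x` otherwise, with `x` evaluated first. The low bits of the number that
is decomposed depend on all bits of `x`: hash values of numerals are computed from their low bits,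
and the caches of the kernel would otherwise degenerate. -/
def evalNonzero {α : Type} (x : ℕ) (z : α) (f : ℕ → α) : α :=
  Nat.rec (motive := fun _ => α) z (fun n _ => f (Nat.shiftRight n.succ 64))
    (Nat.add (Nat.shiftLeft x 64) (Nat.mod x 2305843009213693951))

/-- Remove the lowest bit. -/
def dropLowBit (x : ℕ) : ℕ := Nat.land x (Nat.sub x 1)

/-- The lowest bit. -/
def lowBit (x : ℕ) : ℕ := Nat.xor x (dropLowBit x)

/-- Remove from `R` a greedily chosen set of vertices of `Q`, each new vertex being a member of
`e (2 ^ v)` for all previously chosen `v`. -/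
def dropColor (e : ℕ → ℕ) (fuel : ℕ) : ℕ → ℕ → ℕ :=
  Nat.rec (motive := fun _ => ℕ → ℕ → ℕ) (fun _ R => R)
    (fun _ ih Q R => evalNonzero Q R fun Q =>
      ih (Nat.land Q (e (lowBit Q))) (Nat.xor R (lowBit Q))) fuel

/-- Remove `k` greedily chosen colour classes from `R`. -/
def dropColors (e : ℕ → ℕ) (fuel k : ℕ) : ℕ → ℕ :=
  Nat.rec (motive := fun _ => ℕ → ℕ) (fun R => R)
    (fun _ ih R => evalNonzero R 0 fun R => ih (dropColor e fuel R R)) k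

/-- Apply the test `f` to the part of the neighbourhood `a (2 ^ v)` inside `P`, for each `v` in
`R`, removing `v` from `P` afterwards. -/
def branch (a : ℕ → ℕ) (f : ℕ → Bool) (fuel : ℕ) : ℕ → ℕ → Bool :=
  Nat.rec (motive := fun _ => ℕ → ℕ → Bool) (fun _ _ => false)
    (fun _ ih R P => evalNonzero R true fun R => evalNonzero P true fun P =>
      Bool.rec (motive := fun _ => Bool) false (ih (dropLowBit R) (Nat.xor P (lowBit R)))
        (f (Nat.land P (a (lowBit R))))) fuel

/-- A sufficient test for `P` to contain no clique with `t` vertices. -/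
def noClique (a e : ℕ → ℕ) (fuel t : ℕ) : ℕ → Bool :=
  Nat.rec (motive := fun _ => ℕ → Bool) (fun _ => false)
    (fun k ih P => evalNonzero P true fun P =>
      branch a ih fuel (dropColors e fuel k P) P) t

theorem evalNonzero_of_ne_zero {α : Type} {x : ℕ} (hx : x ≠ 0) (z : α) (f : ℕ → α) :
    evalNonzero x z f = f x := by
  have hlt : x % 2305843009213693951 < 2305843009213693951 := Nat.mod_lt _ (by norm_num)
  obtain ⟨n, hn⟩ : ∃ n, (x <<< 64).add (x % 2305843009213693951) = n + 1 :=
    Nat.exists_eq_succ_of_ne_zero (by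
      change x <<< 64 + x % 2305843009213693951 ≠ 0
      rw [Nat.shiftLeft_eq]; omega)
  have hshift : (n + 1) >>> 64 = x := by
    rw [← hn]
    change (x <<< 64 + x % 2305843009213693951) >>> 64 = x
    rw [Nat.shiftLeft_eq, Nat.shiftRight_eq_div_pow]; omega
  change Nat.rec (motive := fun _ => α) z (fun n _ => f ((n + 1) >>> 64))
    ((x <<< 64).add (x % 2305843009213693951)) = f x
  rw [hn]
  exact congrArg f hshift

theorem exists_lowBit_eq {x : ℕ} (hx : x ≠ 0) : ∃ v, x.testBit v ∧ lowBit x = 2 ^ v := by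
  change ∃ v, x.testBit v ∧ x ^^^ (x &&& (x - 1)) = 2 ^ v
  induction x using Nat.strong_induction_on with
  | _ x ih =>
    obtain ⟨m, rfl | rfl⟩ := Nat.even_or_odd' x
    · obtain ⟨v, hv, h⟩ := ih m (by omega) (by omega)
      refine ⟨v + 1, ?_, Nat.eq_of_testBit_eq fun i => ?_⟩
      · rwa [Nat.testBit_succ, Nat.mul_div_cancel_left _ two_pos]
      · rw [Nat.testBit_xor, Nat.testBit_and]
        cases i with
        | zero => simp [Nat.pow_succ]
        | succ i =>
          rw [Nat.testBit_succ, Nat.testBit_succ, Nat.testBit_succ,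
            Nat.mul_div_cancel_left _ two_pos, show (2 * m - 1) / 2 = m - 1 by omega,
            Nat.pow_succ, Nat.mul_div_cancel _ two_pos, ← h, Nat.testBit_xor, Nat.testBit_and]
    · refine ⟨0, by simp, Nat.eq_of_testBit_eq fun i => ?_⟩
      rw [Nat.testBit_xor, Nat.testBit_and, Nat.add_sub_cancel]
      cases i with
      | zero => simp
      | succ i =>
        rw [Nat.testBit_succ, Nat.testBit_succ, show (2 * m + 1) / 2 = 2 * m / 2 by omega,
          Bool.and_self, Bool.xor_self, Nat.testBit_two_pow_of_ne (by omega)]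

theorem testBit_land (x y i : ℕ) : (Nat.land x y).testBit i = (x.testBit i && y.testBit i) :=
  Nat.testBit_and x y i

theorem testBit_xor_two_pow {R v w : ℕ} (h : w ≠ v) :
    (Nat.xor R (2 ^ v)).testBit w = R.testBit w := by
  change (R ^^^ 2 ^ v).testBit w = _
  rw [Nat.testBit_xor, Nat.testBit_two_pow_of_ne (Ne.symm h), Bool.xor_false]

theorem testBit_dropLowBit {x v w : ℕ} (hv : lowBit x = 2 ^ v) (h : w ≠ v) :
    (dropLowBit x).testBit w = x.testBit w := by
  rw [← testBit_xor_two_pow h, ← hv]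
  change (dropLowBit x ^^^ (x ^^^ dropLowBit x)).testBit w = _
  rw [Nat.xor_comm x, ← Nat.xor_assoc, Nat.xor_self, Nat.zero_xor]

theorem ne_zero_of_testBit {x i : ℕ} (h : x.testBit i = true) : x ≠ 0 := by
  rintro rfl
  simp at h

/-- `s` is a clique for the graph in which `v` has neighbourhood `a (2 ^ v)`, where `e (2 ^ v)`
contains only vertices that are distinct from `v` and not adjacent to it. -/
structure IsBitClique (a e : ℕ → ℕ) (s : Finset ℕ) : Prop where
  adj : ∀ v ∈ s, ∀ w ∈ s, v ≠ w → (a (2 ^ v)).testBit w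
  not_mem : ∀ v ∈ s, ∀ w ∈ s, (e (2 ^ v)).testBit w = false

section

variable {a e : ℕ → ℕ} {s : Finset ℕ}

theorem IsBitClique.mono {t : Finset ℕ} (h : IsBitClique a e s) (hts : t ⊆ s) :
    IsBitClique a e t :=
  ⟨fun v hv w hw => h.adj v (hts hv) w (hts hw),
    fun v hv w hw => h.not_mem v (hts hv) w (hts hw)⟩

theorem dropColor_succ {Q : ℕ} (hQ : Q ≠ 0) (n R : ℕ) :
    dropColor e (n + 1) Q R =
      dropColor e n (Nat.land Q (e (lowBit Q))) (Nat.xor R (lowBit Q)) :=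
  evalNonzero_of_ne_zero hQ R fun Q =>
    dropColor e n (Nat.land Q (e (lowBit Q))) (Nat.xor R (lowBit Q))

theorem dropColors_succ {R : ℕ} (hR : R ≠ 0) (fuel k : ℕ) :
    dropColors e fuel (k + 1) R = dropColors e fuel k (dropColor e fuel R R) :=
  evalNonzero_of_ne_zero hR 0 fun R => dropColors e fuel k (dropColor e fuel R R)

theorem dropColor_of_disjoint (fuel : ℕ) :
    ∀ Q R : ℕ, (∀ w ∈ s, Q.testBit w = false) → (∀ w ∈ s, R.testBit w) →
      ∀ w ∈ s, (dropColor e fuel Q R).testBit w := by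
  induction fuel with
  | zero => exact fun Q R _ hR => hR
  | succ n ih =>
    intro Q R hQ hR
    rcases eq_or_ne Q 0 with rfl | hQ0
    · exact hR
    · rw [dropColor_succ hQ0]
      refine ih _ _ (fun w hw => by rw [testBit_land, hQ w hw, Bool.false_and]) fun w hw => ?_
      obtain ⟨v, hqv, hv⟩ := exists_lowBit_eq hQ0
      rw [hv, testBit_xor_two_pow, hR w hw]
      rintro rfl
      simp [hQ w hw] at hqv

theorem exists_erase_dropColor (hs : IsBitClique a e s) (fuel : ℕ) :
    ∀ Q R : ℕ, (∀ w ∈ s, R.testBit w) →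
      ∃ v, ∀ w ∈ s.erase v, (dropColor e fuel Q R).testBit w := by
  induction fuel with
  | zero => exact fun Q R hR => ⟨0, fun w hw => hR w (Finset.mem_of_mem_erase hw)⟩
  | succ n ih =>
    intro Q R hR
    rcases eq_or_ne Q 0 with rfl | hQ0
    · exact ⟨0, fun w hw => hR w (Finset.mem_of_mem_erase hw)⟩
    · rw [dropColor_succ hQ0]
      obtain ⟨v, -, hqv⟩ := exists_lowBit_eq hQ0
      by_cases hv : v ∈ s
      · refine ⟨v, dropColor_of_disjoint n _ _ (fun w hw => ?_) fun w hw => ?_⟩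
        · rw [testBit_land, hqv, hs.not_mem _ hv _ (Finset.mem_of_mem_erase hw), Bool.and_false]
        · rw [hqv, testBit_xor_two_pow (Finset.ne_of_mem_erase hw),
            hR w (Finset.mem_of_mem_erase hw)]
      · refine ih _ _ fun w hw => ?_
        rw [hqv, testBit_xor_two_pow (ne_of_mem_of_not_mem hw hv), hR w hw]

theorem exists_testBit_dropColors (fuel k : ℕ) :
    ∀ (R : ℕ) (s : Finset ℕ), IsBitClique a e s → (∀ w ∈ s, R.testBit w) → k < s.card →
      ∃ w ∈ s, (dropColors e fuel k R).testBit w := by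
  induction k with
  | zero =>
    intro R s _ hR hk
    obtain ⟨w, hw⟩ := Finset.card_pos.1 hk
    exact ⟨w, hw, hR w hw⟩
  | succ k ih =>
    intro R s hs hR hk
    obtain ⟨w, hw⟩ := Finset.card_pos.1 (Nat.zero_lt_of_lt hk)
    obtain ⟨v, hv⟩ := exists_erase_dropColor hs fuel R R hR
    obtain ⟨u, hu, h⟩ := ih _ (s.erase v) (hs.mono (Finset.erase_subset _ _)) hv
      (by have := Finset.pred_card_le_card_erase (s := s) (a := v); omega)
    exact ⟨u, Finset.mem_of_mem_erase hu, by
      rwa [dropColors_succ (ne_zero_of_testBit (hR w hw))]⟩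

theorem card_ne_of_branch {f : ℕ → Bool} {t : ℕ}
    (hf : ∀ P, f P = true → ∀ s, IsBitClique a e s → (∀ w ∈ s, P.testBit w) → s.card ≠ t)
    (fuel : ℕ) :
    ∀ R P : ℕ, branch a f fuel R P = true → ∀ s, IsBitClique a e s → (∀ w ∈ s, P.testBit w) →
      (∃ w ∈ s, R.testBit w) → s.card ≠ t + 1 := by
  induction fuel with
  | zero => exact fun R P h => Bool.noConfusion h
  | succ n ih =>
    intro R P h s hs hP ⟨u, hu, hR⟩
    have hR0 := ne_zero_of_testBit hR
    obtain ⟨v, -, hrv⟩ := exists_lowBit_eq hR0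
    change evalNonzero R true (fun R => evalNonzero P true fun P =>
      Bool.rec (motive := fun _ => Bool) false
        (branch a f n (dropLowBit R) (Nat.xor P (lowBit R)))
        (f (Nat.land P (a (lowBit R))))) = true at h
    rw [evalNonzero_of_ne_zero hR0, evalNonzero_of_ne_zero (ne_zero_of_testBit (hP u hu))] at h
    cases hfv : f (Nat.land P (a (lowBit R))) with
    | false => rw [hfv] at h; exact Bool.noConfusion h
    | true =>
      rw [hfv] at h
      by_cases hv : v ∈ s
      · intro hc
        refine hf _ hfv (s.erase v) (hs.mono (Finset.erase_subset _ _))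
          (fun w hw => ?_) (by rw [Finset.card_erase_of_mem hv, hc, Nat.add_sub_cancel])
        rw [testBit_land, hP w (Finset.mem_of_mem_erase hw), hrv,
          hs.adj _ hv w (Finset.mem_of_mem_erase hw) (Finset.ne_of_mem_erase hw).symm,
          Bool.and_true]
      · have hne : ∀ w ∈ s, w ≠ v := fun w hw => ne_of_mem_of_not_mem hw hv
        refine ih _ _ h s hs (fun w hw => ?_) ⟨u, hu, ?_⟩
        · rw [hrv, testBit_xor_two_pow (hne w hw), hP w hw]
        · rw [testBit_dropLowBit hrv (hne u hu), hR]

theorem card_ne_of_noClique (fuel t : ℕ) :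
    ∀ P : ℕ, noClique a e fuel t P = true → ∀ s, IsBitClique a e s → (∀ w ∈ s, P.testBit w) →
      s.card ≠ t := by
  induction t with
  | zero => exact fun P h => Bool.noConfusion h
  | succ k ih =>
    intro P h s hs hP hc
    obtain ⟨w, hw⟩ := Finset.card_pos.1 (by omega : 0 < s.card)
    change evalNonzero P true (fun P => branch a (noClique a e fuel k) fuel
      (dropColors e fuel k P) P) = true at h
    rw [evalNonzero_of_ne_zero (ne_zero_of_testBit (hP w hw))] at h
    exact card_ne_of_branch ih fuel _ _ h s hs hP
      (exists_testBit_dropColors fuel k _ s hs hP (by omega)) hc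

end

/-! ### Circulant graphs on `ZMod 266` invariant under the multipliers -/

/-- The subgroup of the units of `ZMod 266` generated by `39` and `-1`. -/
def multipliers : List ℕ := [1, 39, 191, 265, 227, 75]

/-- The bits of `orbitMask L` are the multiples of members of `L` by multipliers. -/
def orbitMask (L : List ℕ) : ℕ :=
  L.foldr (fun r M => multipliers.foldr (fun h M => M ||| 1 <<< (h * r % 266)) M) 0

/-- If `D₂` is `D + 2 ^ 266 * D` and `b` is `2 ^ v`, then the bits `w < 266` of this number are
those for which `w - v` is in `D` modulo `266`. -/
def rotate (D₂ b : ℕ) : ℕ := Nat.shiftRight (Nat.mul D₂ b) 266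

/-- No clique with `t` vertices contains both `0` and `r`, where `D₂` and `E₂` are the doubled
masks of the connection set and of its complement. -/
def noCliqueThrough (t r D₂ E₂ : ℕ) : Bool :=
  noClique (rotate D₂) (rotate E₂) 266 (t - 2) (Nat.land (rotate D₂ 1) (rotate D₂ (2 ^ (r % 266))))

/-- The search `noCliqueThrough`, where differences are in the orbits of `r` and of members of
`L`. -/
def noCliqueThroughHead (t r : ℕ) (L : List ℕ) : Bool :=
  evalNonzero (orbitMask (r :: L)) false fun D =>
    evalNonzero (D ||| D <<< 266) false fun D₂ =>
      evalNonzero (2 ^ 266 - 1 ^^^ (D ||| 1)) false fun E =>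
        evalNonzero (E ||| E <<< 266) false fun E₂ => noCliqueThrough t r D₂ E₂

/-- Exclude `t`-cliques using a difference in the orbit of each member of `L` in turn. -/
def noCliqueOrbits (t : ℕ) (L : List ℕ) : Bool :=
  List.rec (motive := fun _ => Bool) true
    (fun r L ih => Bool.rec (motive := fun _ => Bool) false ih (noCliqueThroughHead t r L)) L

/-- Orbit representatives of the connection set. -/
def edgeOrbits : List ℕ :=
  [3, 4, 7, 9, 19, 21, 22, 23, 26, 36, 49, 52, 56, 63, 65, 66, 70, 72, 77, 84, 105, 119, 133]

/-- Orbit representatives of the other nonzero residues, except for the two orbits with the longest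
searches. -/
def easyNonedgeOrbits : List ℕ :=
  [42, 12, 5, 13, 51, 58, 18, 35, 10, 73, 33, 28, 2, 126, 59, 44, 6, 29, 24, 112, 37, 1, 16, 14,
    31, 45, 8, 98, 30, 15, 91, 38]

/-- Orbit representatives of the nonzero residues outside the connection set. -/
def nonedgeOrbits : List ℕ := 11 :: 17 :: easyNonedgeOrbits

/-- `d` is the product of a multiplier and a member of `L`. -/
def Conn (L : List ℕ) (d : ZMod 266) : Prop :=
  ∃ r ∈ L, ∃ h ∈ multipliers, d = ((h * r : ℕ) : ZMod 266)

theorem exists_multiplier_mul_eq_one :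
    ∀ h ∈ multipliers, ∃ b ∈ multipliers, (b : ZMod 266) * h = 1 := by
  decide

theorem exists_multiplier_eq_mul :
    ∀ b ∈ multipliers, ∀ h ∈ multipliers, ∃ c ∈ multipliers, (c : ZMod 266) = b * h := by
  decide

theorem Conn.mul {L : List ℕ} {d : ZMod 266} (hd : Conn L d) {b : ℕ} (hb : b ∈ multipliers) :
    Conn L (b * d) := by
  obtain ⟨r, hr, h, hh, rfl⟩ := hd
  obtain ⟨c, hc, hcb⟩ := exists_multiplier_eq_mul b hb h hh
  exact ⟨r, hr, c, hc, by push_cast; rw [hcb, mul_assoc]⟩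

theorem Conn.neg {L : List ℕ} {d : ZMod 266} (hd : Conn L d) : Conn L (-d) := by
  have h : ((265 : ℕ) : ZMod 266) = -1 := by decide
  rw [← neg_one_mul, ← h]
  exact hd.mul (by decide)

theorem testBit_foldr_or_shiftLeft (g : ℕ → ℕ) (L : List ℕ) (M i : ℕ) :
    (L.foldr (fun h M => M ||| 1 <<< g h) M).testBit i = true ↔
      M.testBit i = true ∨ ∃ h ∈ L, i = g h := by
  induction L with
  | nil => simp
  | cons h L ih =>
    rw [List.foldr_cons, Nat.testBit_or, Bool.or_eq_true, ih, Nat.one_shiftLeft,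
      Nat.testBit_two_pow, decide_eq_true_eq]
    simp only [List.mem_cons, exists_eq_or_imp]
    rw [or_assoc, or_comm (b := g h = i), eq_comm (a := g h)]

theorem testBit_orbitMask (L : List ℕ) (i : ℕ) :
    (orbitMask L).testBit i = true ↔ ∃ r ∈ L, ∃ h ∈ multipliers, i = h * r % 266 := by
  induction L with
  | nil => simp [orbitMask]
  | cons r L ih =>
    change (multipliers.foldr (fun h M => M ||| 1 <<< (h * r % 266)) (orbitMask L)).testBit i =
      true ↔ _
    rw [testBit_foldr_or_shiftLeft fun h => h * r % 266, ih]
    simp only [List.mem_cons, exists_eq_or_imp]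
    rw [or_comm]

theorem testBit_orbitMask_val (L : List ℕ) (d : ZMod 266) :
    (orbitMask L).testBit d.val = true ↔ Conn L d := by
  rw [testBit_orbitMask]
  refine exists_congr fun r => and_congr_right fun _ => exists_congr fun h =>
    and_congr_right fun _ => ?_
  rw [← ZMod.val_natCast, (ZMod.val_injective 266).eq_iff]

theorem testBit_rotate {D : ℕ} (hD : ∀ i, D.testBit i = true → i < 266) (x y : ZMod 266) :
    (rotate (D ||| D <<< 266) (2 ^ x.val)).testBit y.val = D.testBit (y - x).val := by
  have hx := x.val_lt
  have hy := y.val_lt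
  have hsub : (y - x).val = (y.val + 266 - x.val) % 266 := by
    rw [← ZMod.val_natCast, Nat.cast_sub (by omega)]
    simp [show (266 : ZMod 266) = 0 from rfl]
  change (((D ||| D <<< 266) * 2 ^ x.val) >>> 266).testBit y.val = _
  rw [Nat.testBit_shiftRight, Nat.testBit_mul_two_pow, hsub, Nat.testBit_or,
    Nat.testBit_shiftLeft]
  have hout : ∀ i, 266 ≤ i → D.testBit i = false := fun i hi =>
    Bool.eq_false_iff.2 fun h => by have := hD i h; omega
  generalize x.val = v at *
  generalize y.val = w at *
  rcases le_or_gt v w with h | h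
  · rw [hout (266 + w - v) (by omega), show (w + 266 - v) % 266 = 266 + w - v - 266 by omega]
    simp [show v ≤ 266 + w by omega, show 266 ≤ 266 + w - v by omega]
  · rw [show (w + 266 - v) % 266 = 266 + w - v by omega]
    simp [show v ≤ 266 + w by omega, show ¬266 ≤ 266 + w - v by omega]

theorem eq_true_of_evalNonzero {x : ℕ} {f : ℕ → Bool} (h : evalNonzero x false f = true) :
    f x = true := by
  rcases eq_or_ne x 0 with rfl | hx
  · exact Bool.noConfusion h
  · rwa [evalNonzero_of_ne_zero hx] at h

set_option exponentiation.threshold 266 in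
theorem card_ne_of_noCliqueThroughHead {t r : ℕ} {L : List ℕ}
    (h : noCliqueThroughHead t r L = true) {s : Finset (ZMod 266)}
    (hs : ∀ x ∈ s, ∀ y ∈ s, x ≠ y → Conn (r :: L) (x - y)) (h0 : 0 ∈ s)
    (hr : (r : ZMod 266) ∈ s) (hr0 : (r : ZMod 266) ≠ 0) : s.card ≠ t := by
  rw [noCliqueThroughHead] at h
  iterate 4 replace h := eq_true_of_evalNonzero h
  set D := orbitMask (r :: L)
  have hD : ∀ i, D.testBit i = true → i < 266 := fun i hi => by
    obtain ⟨_, _, _, _, rfl⟩ := (testBit_orbitMask _ _).1 hi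
    exact Nat.mod_lt _ (by norm_num)
  have hEbit : ∀ i, (2 ^ 266 - 1 ^^^ (D ||| 1)).testBit i =
      (decide (i < 266) && !D.testBit i && decide (i ≠ 0)) := by
    intro i
    rw [Nat.testBit_xor, Nat.testBit_two_pow_sub_one, Nat.testBit_or,
      ← pow_zero 2, Nat.testBit_two_pow]
    by_cases hi : i < 266
    · simp [hi, eq_comm]
    · simp [hi, Bool.eq_false_iff.2 (mt (hD i) hi)]
      omega
  have hE : ∀ i, (2 ^ 266 - 1 ^^^ (D ||| 1)).testBit i = true → i < 266 := fun i hi => by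
    rw [hEbit] at hi
    simp_all
  have hadj : ∀ x ∈ s, ∀ y ∈ s, x ≠ y → D.testBit (y - x).val = true := fun x hx y hy hxy =>
    (testBit_orbitMask_val _ _).2 (hs y hy x hx hxy.symm)
  intro hc
  refine card_ne_of_noClique 266 (t - 2) _ h
    (((s.erase 0).erase (r : ZMod 266)).map ⟨ZMod.val, ZMod.val_injective 266⟩) ⟨?_, ?_⟩ ?_ ?_
  · simp only [Finset.mem_map, Finset.mem_erase, Function.Embedding.coeFn_mk]
    rintro _ ⟨x, ⟨-, -, hx⟩, rfl⟩ _ ⟨y, ⟨-, -, hy⟩, rfl⟩ hxy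
    rw [testBit_rotate hD]
    exact hadj x hx y hy fun h => hxy (congrArg _ h)
  · simp only [Finset.mem_map, Finset.mem_erase, Function.Embedding.coeFn_mk]
    rintro _ ⟨x, ⟨-, -, hx⟩, rfl⟩ _ ⟨y, ⟨-, -, hy⟩, rfl⟩
    rw [testBit_rotate hE, hEbit]
    rcases eq_or_ne x y with rfl | hxy
    · simp
    · simp [hadj x hx y hy hxy]
  · simp only [Finset.mem_map, Finset.mem_erase, Function.Embedding.coeFn_mk]
    rintro _ ⟨x, ⟨hxr, hx0, hx⟩, rfl⟩
    rw [testBit_land, ← ZMod.val_natCast, testBit_rotate hD, hadj _ hr _ hx hxr.symm,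
      ← pow_zero 2, ← ZMod.val_zero (n := 266), testBit_rotate hD, hadj _ h0 _ hx hx0.symm,
      Bool.and_self]
  · rw [Finset.card_map, Finset.card_erase_of_mem (Finset.mem_erase.2 ⟨hr0, hr⟩),
      Finset.card_erase_of_mem h0, hc, Nat.sub_sub]

theorem noCliqueOrbits_cons {t r : ℕ} {L : List ℕ} (hr : noCliqueThroughHead t r L = true)
    (hL : noCliqueOrbits t L = true) : noCliqueOrbits t (r :: L) = true := by
  change Bool.rec (motive := fun _ => Bool) false (noCliqueOrbits t L)
    (noCliqueThroughHead t r L) = true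
  rwa [hr]

theorem card_ne_of_noCliqueOrbits {t : ℕ} (ht : 2 ≤ t) {L : List ℕ}
    (h : noCliqueOrbits t L = true) (s : Finset (ZMod 266))
    (hs : ∀ x ∈ s, ∀ y ∈ s, x ≠ y → Conn L (x - y)) : s.card ≠ t := by
  induction L with
  | nil =>
    intro hc
    obtain ⟨x, hx, y, hy, hxy⟩ := Finset.one_lt_card.1 (by omega : 1 < s.card)
    obtain ⟨r, hr, -⟩ := hs x hx y hy hxy
    exact List.not_mem_nil hr
  | cons r L ih =>
    change Bool.rec (motive := fun _ => Bool) false (noCliqueOrbits t L)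
      (noCliqueThroughHead t r L) = true at h
    cases hhead : noCliqueThroughHead t r L with
    | false => rw [hhead] at h; exact Bool.noConfusion h
    | true =>
      rw [hhead] at h
      by_cases hex : ∃ x ∈ s, ∃ y ∈ s, x ≠ y ∧
          ∃ m ∈ multipliers, x - y = ((m * r : ℕ) : ZMod 266)
      · obtain ⟨x, hx, y, hy, hxy, m, hm, hd⟩ := hex
        obtain ⟨b, hb, hbm⟩ := exists_multiplier_mul_eq_one m hm
        have hr : (b : ZMod 266) * (x - y) = r := by
          rw [hd]; push_cast; rw [← mul_assoc, hbm, one_mul]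
        have hinj : Function.Injective fun z : ZMod 266 => (b : ZMod 266) * (z - y) :=
          fun z w hzw => by
            have := congrArg (· * (m : ZMod 266)) hzw
            simpa only [mul_right_comm _ _ (m : ZMod 266), hbm, one_mul, sub_left_inj] using this
        rw [← Finset.card_map ⟨_, hinj⟩]
        refine card_ne_of_noCliqueThroughHead hhead ?_ ?_ ?_ ?_
        · simp only [Finset.mem_map, Function.Embedding.coeFn_mk]
          rintro _ ⟨z, hz, rfl⟩ _ ⟨w, hw, rfl⟩ hzw
          rw [← mul_sub, sub_sub_sub_cancel_right]
          exact (hs z hz w hw fun h => hzw (by rw [h])).mul hb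
        · exact Finset.mem_map.2 ⟨y, hy, by simp⟩
        · exact Finset.mem_map.2 ⟨x, hx, hr⟩
        · rw [← hr, ← mul_zero (b : ZMod 266), ← sub_self y]
          exact hinj.ne hxy
      · refine ih h fun x hx y hy hxy => ?_
        obtain ⟨r', hr', m, hm, hd⟩ := hs x hx y hy hxy
        rcases List.mem_cons.1 hr' with rfl | hr'
        · exact absurd ⟨x, hx, y, hy, hxy, m, hm, hd⟩ hex
        · exact ⟨r', hr', m, hm, hd⟩

theorem noCliqueOrbits_edgeOrbits : noCliqueOrbits 5 edgeOrbits = true := by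
  decide +kernel

theorem noCliqueOrbits_easyNonedgeOrbits : noCliqueOrbits 14 easyNonedgeOrbits = true := by
  decide +kernel

theorem noCliqueThroughHead_seventeen :
    noCliqueThroughHead 14 17 easyNonedgeOrbits = true := by
  decide +kernel

theorem noCliqueThroughHead_eleven :
    noCliqueThroughHead 14 11 (17 :: easyNonedgeOrbits) = true := by
  decide +kernel

theorem noCliqueOrbits_nonedgeOrbits : noCliqueOrbits 14 nonedgeOrbits = true :=
  noCliqueOrbits_cons noCliqueThroughHead_eleven
    (noCliqueOrbits_cons noCliqueThroughHead_seventeen noCliqueOrbits_easyNonedgeOrbits)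

theorem conn_edgeOrbits_or_nonedgeOrbits {d : ZMod 266} (hd : d ≠ 0) :
    Conn edgeOrbits d ∨ Conn nonedgeOrbits d := by
  have h : ∀ i < 266, i ≠ 0 → ((orbitMask edgeOrbits).testBit i ||
      (orbitMask nonedgeOrbits).testBit i) = true := by
    decide +kernel
  simpa [testBit_orbitMask_val] using h d.val d.val_lt ((ZMod.val_ne_zero d).2 hd)

/-- The embedding of the vertices as residues. -/
def residue : Fin 241 ↪ ZMod 266 :=
  ⟨fun i => (i : ℕ), fun i j h => by
    have := congrArg ZMod.val h
    rw [ZMod.val_natCast, ZMod.val_natCast] at this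
    omega⟩

theorem cliqueFree_of_noCliqueOrbits {t : ℕ} (ht : 2 ≤ t) {L : List ℕ}
    (h : noCliqueOrbits t L = true) {G : SimpleGraph (Fin 241)}
    (hG : ∀ i j, G.Adj i j → Conn L (residue i - residue j)) : G.CliqueFree t := by
  rintro s ⟨hs, hc⟩
  refine card_ne_of_noCliqueOrbits ht h (s.map residue) (fun x hx y hy hxy => ?_)
    (by rw [Finset.card_map, hc])
  obtain ⟨i, hi, rfl⟩ := Finset.mem_map.1 hx
  obtain ⟨j, hj, rfl⟩ := Finset.mem_map.1 hy
  exact hG i j (hs hi hj fun h => hxy (by rw [h]))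

/-- Vertices are adjacent when their difference is not in the orbit of a member of
`nonedgeOrbits`. -/
def graph : SimpleGraph (Fin 241) where
  Adj i j := i ≠ j ∧ ¬Conn nonedgeOrbits (residue i - residue j)
  symm := ⟨fun i j h => ⟨h.1.symm, fun hc => h.2 (by simpa using hc.neg)⟩⟩
  loopless := ⟨fun i h => h.1 rfl⟩

end CirculantRamsey

open CirculantRamsey in
theorem ramsey_lower_bound_R_5_14 :
    ∃ G : SimpleGraph (Fin 241), G.CliqueFree 5 ∧ Gᶜ.CliqueFree 14 := by
  refine ⟨graph, cliqueFree_of_noCliqueOrbits (by norm_num) noCliqueOrbits_edgeOrbits ?_,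
    cliqueFree_of_noCliqueOrbits (by norm_num) noCliqueOrbits_nonedgeOrbits ?_⟩
  · rintro i j ⟨hij, hc⟩
    exact (conn_edgeOrbits_or_nonedgeOrbits
      (sub_ne_zero.2 (residue.injective.ne hij))).resolve_right hc
  · intro i j h
    by_contra hc
    exact ((SimpleGraph.compl_adj _ _ _).1 h).2 ⟨h.ne, hc⟩
end

section
/- R(5,16) ≥ 293; that is, there exists a 2-coloring of the edges of the complete graph K_292 containing no monochromatic K_5 in color 1 and no monochromatic K_16 in color 2. -/
namespace RamseyLowerBound

/-- Four copies of `G`, indexed by `Fin 4`: vertices over `G`-adjacent base points are joined, each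
fiber is the 4-cycle with parts `{0, 1}` and `{2, 3}`, and for `v < w` the `i`-th copy of `v` is
joined to the `(i + 1)`-st copy of `w`. -/
def fourfoldGraph {V : Type*} [LinearOrder V] (G : SimpleGraph V) : SimpleGraph (V × Fin 4) where
  Adj x y := G.Adj x.1 y.1 ∨ (x.1 = y.1 ∧ x.2.val / 2 ≠ y.2.val / 2) ∨
    (x.1 < y.1 ∧ y.2 = x.2 + 1) ∨ (y.1 < x.1 ∧ x.2 = y.2 + 1)
  symm := ⟨fun x y h => by
    rcases h with h | ⟨h, h'⟩ | h | h
    · exact Or.inl h.symm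
    · exact Or.inr (Or.inl ⟨h.symm, h'.symm⟩)
    · exact Or.inr (Or.inr (Or.inr h))
    · exact Or.inr (Or.inr (Or.inl h))⟩
  loopless := ⟨fun x h => by simp at h⟩

namespace fourfoldGraph

variable {V : Type*} [LinearOrder V] {G : SimpleGraph V}

theorem fst_eq_of_parity_eq {x y : V × Fin 4} (h : (fourfoldGraph G).Adj x y)
    (hp : x.2.val % 2 = y.2.val % 2) (hG : ¬ G.Adj x.1 y.1) : x.1 = y.1 := by
  obtain ⟨v, i⟩ := x
  obtain ⟨w, j⟩ := y
  rcases h with h | ⟨h, -⟩ | ⟨-, h⟩ | ⟨-, h⟩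
  · exact absurd h hG
  · exact h
  · simp only at h hp
    subst h
    have hpar : ∀ k : Fin 4, (k + 1).val % 2 ≠ k.val % 2 := by decide
    exact absurd hp.symm (hpar i)
  · simp only at h hp
    subst h
    have hpar : ∀ k : Fin 4, (k + 1).val % 2 ≠ k.val % 2 := by decide
    exact absurd hp (hpar j)

theorem adj_fst_of_adj_antipodal {x y z : V × Fin 4} (hxy : (fourfoldGraph G).Adj x y)
    (hfst : x.1 = y.1) (hp : x.2.val % 2 = y.2.val % 2) (hxz : (fourfoldGraph G).Adj x z)
    (hyz : (fourfoldGraph G).Adj y z) : G.Adj x.1 z.1 := by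
  obtain ⟨v, i⟩ := x
  obtain ⟨w, j⟩ := y
  obtain ⟨u, k⟩ := z
  obtain rfl : v = w := hfst
  have hij : i ≠ j := by
    rintro rfl
    exact (fourfoldGraph G).irrefl hxy
  by_contra hG
  simp only [fourfoldGraph] at hxz hyz hp hG
  rcases lt_trichotomy v u with h | rfl | h
  · simp only [hG, h, h.ne, h.not_gt, false_and, true_and, or_false, false_or] at hxz hyz
    exact hij (add_right_cancel (hxz.symm.trans hyz))
  · simp only [hG, lt_irrefl, false_and, true_and, or_false, false_or] at hxz hyz
    clear hxy
    revert i j k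
    decide
  · simp only [hG, h, h.ne', h.not_gt, false_and, true_and, false_or] at hxz hyz
    exact hij (hxz.trans hyz.symm)

theorem exists_adj_fst_of_triangle {x y z : V × Fin 4} (hxy : (fourfoldGraph G).Adj x y)
    (hxz : (fourfoldGraph G).Adj x z) (hyz : (fourfoldGraph G).Adj y z) :
    G.Adj x.1 y.1 ∨ G.Adj x.1 z.1 ∨ G.Adj y.1 z.1 := by
  by_contra! h
  obtain ⟨h₁, h₂, h₃⟩ := h
  have hp : x.2.val % 2 = y.2.val % 2 ∨ x.2.val % 2 = z.2.val % 2 ∨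
      y.2.val % 2 = z.2.val % 2 := by omega
  rcases hp with hp | hp | hp
  · exact h₂ (adj_fst_of_adj_antipodal hxy (fst_eq_of_parity_eq hxy hp h₁) hp hxz hyz)
  · exact h₁ (adj_fst_of_adj_antipodal hxz (fst_eq_of_parity_eq hxz hp h₂) hp hxy hyz.symm)
  · exact h₁ (adj_fst_of_adj_antipodal hyz (fst_eq_of_parity_eq hyz hp h₃) hp hxy.symm
      hxz.symm).symm

theorem not_triangle (hG : G.CliqueFree 3) {u v w : V} (huv : G.Adj u v) (huw : G.Adj u w) :
    ¬ G.Adj v w := fun hvw =>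
  hG {u, v, w} (SimpleGraph.is3Clique_triple_iff.2 ⟨huv, huw, hvw⟩)

theorem cliqueFree_five (hG : G.CliqueFree 3) : (fourfoldGraph G).CliqueFree 5 := by
  classical
  intro s hs
  have hadj : ∀ x ∈ s, ∀ y ∈ s, x ≠ y → (fourfoldGraph G).Adj x y :=
    fun x hx y hy hxy => hs.isClique hx hy hxy
  have key : ∀ x ∈ s, ∀ y ∈ s, x ≠ y → x.2.val % 2 = y.2.val % 2 → G.Adj x.1 y.1 := by
    intro x hx y hy hxy hp
    by_contra hn
    have hxy' := hadj x hx y hy hxy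
    have hfst := fst_eq_of_parity_eq hxy' hp hn
    have hcard : (s \ {x, y}).card = 3 := by
      rw [Finset.card_sdiff_of_subset (by simp [Finset.insert_subset_iff, hx, hy]),
        Finset.card_pair hxy, hs.card_eq]
    obtain ⟨a, b, c, hab, hac, hbc, habc⟩ := Finset.card_eq_three.1 hcard
    have hmem : ∀ z ∈ ({a, b, c} : Finset (V × Fin 4)), z ∈ s ∧ G.Adj x.1 z.1 := by
      intro z hz
      rw [← habc, Finset.mem_sdiff, Finset.mem_insert, Finset.mem_singleton, not_or] at hz
      exact ⟨hz.1, adj_fst_of_adj_antipodal hxy' hfst hp (hadj x hx z hz.1 (Ne.symm hz.2.1))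
        (hadj y hy z hz.1 (Ne.symm hz.2.2))⟩
    obtain ⟨ha, hxa⟩ := hmem a (by simp)
    obtain ⟨hb, hxb⟩ := hmem b (by simp)
    obtain ⟨hc, hxc⟩ := hmem c (by simp)
    rcases exists_adj_fst_of_triangle (hadj a ha b hb hab) (hadj a ha c hc hac)
      (hadj b hb c hc hbc) with h | h | h
    · exact not_triangle hG hxa hxb h
    · exact not_triangle hG hxa hxc h
    · exact not_triangle hG hxb hxc h
  obtain ⟨p, -, hp⟩ := Finset.exists_lt_card_fiber_of_mul_lt_card_of_maps_to
    (s := s) (t := Finset.range 2) (f := fun x => x.2.val % 2) (n := 2)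
    (fun x _ => Finset.mem_range.2 (Nat.mod_lt _ two_pos)) (by simp [hs.card_eq])
  obtain ⟨a, b, c, ha, hb, hc, hab, hac, hbc⟩ := Finset.two_lt_card_iff.1 hp
  rw [Finset.mem_filter] at ha hb hc
  exact not_triangle hG (key a ha.1 b hb.1 hab (ha.2.trans hb.2.symm))
    (key a ha.1 c hc.1 hac (ha.2.trans hc.2.symm)) (key b hb.1 c hc.1 hbc (hb.2.trans hc.2.symm))

theorem compl_cliqueFree_succ {l : ℕ} (hG : Gᶜ.CliqueFree l) :
    (fourfoldGraph G)ᶜ.CliqueFree (l + 1) := by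
  classical
  intro s hs
  have hadj : ∀ x ∈ s, ∀ y ∈ s, ¬ (fourfoldGraph G).Adj x y := by
    intro x hx y hy h
    exact ((SimpleGraph.compl_adj _ _ _).1 (hs.isClique hx hy h.ne)).2 h
  set r := s.filter fun x => x.2.val % 2 = 1 ∧ (x.1, x.2 - 1) ∈ s with hr
  have hr_card : r.card ≤ 1 := by
    have hlt : ∀ x ∈ r, ∀ y ∈ r, ¬ x.1 < y.1 := by
      rintro ⟨v, i⟩ hx ⟨w, j⟩ hy h
      simp only [hr, Finset.mem_filter] at hx hy h
      have h₁ := hadj _ hx.2.2 _ hy.1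
      have h₂ := hadj _ hx.1 _ hy.2.2
      simp only [fourfoldGraph, not_or, h, true_and] at h₁ h₂
      have h₃ := h₁.2.2.1
      have h₄ := h₂.2.2.1
      have h₅ := hx.2.1
      have h₆ := hy.2.1
      clear h₁ h₂ hx hy
      revert h₃ h₄ h₅ h₆
      revert i j
      decide
    rw [Finset.card_le_one]
    intro x hx y hy
    have hfst : x.1 = y.1 := le_antisymm (not_lt.1 (hlt y hy x hx)) (not_lt.1 (hlt x hx y hy))
    refine Prod.ext hfst ?_
    simp only [hr, Finset.mem_filter] at hx hy
    have h := hadj _ hx.1 _ hy.1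
    simp only [fourfoldGraph, not_or, hfst, true_and, not_not] at h
    have := hx.2.1
    have := hy.2.1
    omega
  have hinj : Set.InjOn Prod.fst (↑(s \ r) : Set (V × Fin 4)) := by
    rintro ⟨v, i⟩ hx ⟨w, j⟩ hy hfst
    obtain rfl : v = w := hfst
    simp only [hr, Finset.coe_sdiff, Set.mem_sdiff, Finset.mem_coe, Finset.mem_filter,
      not_and] at hx hy
    have h := hadj _ hx.1 _ hy.1
    simp only [fourfoldGraph, not_or, true_and, not_not] at h
    have h₁ := hx.2 hx.1
    have h₂ := hy.2 hy.1
    have hij : i = j ∨ (i.val % 2 = 1 ∧ i - 1 = j) ∨ (j.val % 2 = 1 ∧ j - 1 = i) := by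
      have := h.2.1
      clear h h₁ h₂ hx hy
      revert i j
      decide
    rcases hij with h | ⟨h, h'⟩ | ⟨h, h'⟩
    · rw [h]
    · exact absurd (h' ▸ hy.1) (h₁ h)
    · exact absurd (h' ▸ hx.1) (h₂ h)
  have hcard : l ≤ ((s \ r).image Prod.fst).card := by
    rw [Finset.card_image_of_injOn hinj]
    have := Finset.le_card_sdiff r s
    have := hs.card_eq
    omega
  refine hG.mono hcard _ ⟨?_, rfl⟩
  intro v hv w hw hvw
  simp only [Finset.coe_image, Set.mem_image, Finset.mem_coe, Finset.mem_sdiff] at hv hw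
  obtain ⟨x, hx, rfl⟩ := hv
  obtain ⟨y, hy, rfl⟩ := hw
  exact (SimpleGraph.compl_adj _ _ _).2 ⟨hvw, fun h => hadj x hx.1 y hy.1 (Or.inl h)⟩

end fourfoldGraph

/-- Applies `f` to `n`, making the kernel evaluate `n` to a literal first. -/
def applyEvaluated {α : Type*} (f : ℕ → α) (n : ℕ) : α :=
  Nat.rec (f 0) (fun m _ => f m.succ) n

/-- Removes from the vertex set `c` up to `k` vertices or pairs of adjacent vertices, greedily.
Vertex sets are encoded as bit masks, and `N (2 ^ v)` is the set of neighbors of `v`. -/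
def greedyResidual (N : ℕ → ℕ) (k : ℕ) : ℕ → ℕ :=
  Nat.rec (fun c => c)
    (fun _ remove c => Nat.rec 0
      (fun m _ => applyEvaluated
        (fun c' => Nat.rec (remove c')
          (fun t _ => remove (Nat.xor c' (Nat.xor t.succ (Nat.land t.succ t))))
          (Nat.land (N (Nat.xor m.succ c')) c'))
        (Nat.land m.succ m)) c) k

/-- Checks with `check` that no independent subset of `c` contains one more vertex than `check`
excludes and meets `r`, branching on the vertices of `r`. -/
def branchOn (N : ℕ → ℕ) (check : ℕ → Bool) (fuel : ℕ) : ℕ → ℕ → Bool :=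
  Nat.rec (fun _ _ => false)
    (fun _ loop c r => Nat.rec true
      (fun m _ => applyEvaluated
        (fun r' => applyEvaluated
          (fun b => applyEvaluated
            (fun d => and (check (Nat.xor d (Nat.land (N b) d))) (loop d r')) (Nat.xor c b))
          (Nat.xor m.succ r'))
        (Nat.land m.succ m)) r) fuel

/-- Branch and bound check that `c` contains no independent set of size `k`. -/
def noIndepSet (N : ℕ → ℕ) (fuel k : ℕ) : ℕ → Bool :=
  Nat.rec (fun _ => false)
    (fun k check c => branchOn N check fuel c (greedyResidual N k c)) k

theorem applyEvaluated_eq {α : Type*} (f : ℕ → α) (n : ℕ) : applyEvaluated f n = f n := by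
  cases n <;> rfl

theorem exists_testBit_xor_land_pred (m : ℕ) :
    ∃ v, m.succ.testBit v = true ∧ Nat.land m.succ m = m.succ ^^^ 2 ^ v := by
  change ∃ v, _ ∧ (m + 1) &&& m = _
  induction m using Nat.strong_induction_on with
  | _ m ih =>
    rcases Nat.even_or_odd' m with ⟨j, rfl | rfl⟩
    · refine ⟨0, by simp, Nat.eq_of_testBit_eq fun i => ?_⟩
      rw [Nat.testBit_and, Nat.testBit_xor, Nat.testBit_two_pow]
      cases i with
      | zero => simp
      | succ i =>
        have : (2 * j + 1) / 2 = j := by omega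
        simp [Nat.testBit_succ, this]
    · obtain ⟨v, hv, h⟩ := ih j (by omega)
      have h₁ : (2 * j + 1).succ = 2 * j.succ := by omega
      refine ⟨v + 1, by rw [h₁, Nat.testBit_succ]; simpa using hv,
        Nat.eq_of_testBit_eq fun i => ?_⟩
      rw [Nat.testBit_and, Nat.testBit_xor, Nat.testBit_two_pow]
      cases i with
      | zero =>
        have h₂ : (2 * j + 1 + 1) % 2 = 0 := by omega
        simp [Nat.testBit_zero, h₂]
      | succ i =>
        have h₂ : (2 * j + 1 + 1) / 2 = j + 1 := by omega
        have h₃ : (2 * j + 1) / 2 = j := by omega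
        have h₄ := congrArg (fun n => n.testBit i) h
        simp only [Nat.testBit_and, Nat.testBit_xor, Nat.testBit_two_pow,
          Nat.succ_eq_add_one] at h₄
        simp [Nat.testBit_succ, h₂, h₃, h₄]

section

variable {N : ℕ → ℕ} {s : Finset ℕ}

theorem card_filter_testBit_le {c d : ℕ} (x : ℕ)
    (h : ∀ u ∈ s, c.testBit u = true → u = x ∨ d.testBit u = true) :
    (s.filter fun u => c.testBit u = true).card ≤
      (s.filter fun u => d.testBit u = true).card + 1 := by
  refine (Finset.card_le_card (t := insert x (s.filter fun u => d.testBit u = true)) ?_).trans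
    (Finset.card_insert_le _ _)
  intro u hu
  rw [Finset.mem_filter] at hu
  simpa [hu.1] using h u hu.1 hu.2

theorem card_filter_le_greedyResidual
    (hs : (s : Set ℕ).Pairwise fun v w => (N (2 ^ v)).testBit w = false) (k c : ℕ) :
    (s.filter fun u => c.testBit u = true).card ≤
      (s.filter fun u => (greedyResidual N k c).testBit u = true).card + k := by
  induction k generalizing c with
  | zero => exact le_rfl
  | succ k ih =>
    obtain _ | m := c
    · simp
    obtain ⟨v, -, hv⟩ := exists_testBit_xor_land_pred m
    have hstep : greedyResidual N (k + 1) (m + 1) = applyEvaluated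
        (fun c' => Nat.rec (greedyResidual N k c')
          (fun t _ => greedyResidual N k (Nat.xor c' (Nat.xor t.succ (Nat.land t.succ t))))
          (Nat.land (N (Nat.xor m.succ c')) c')) (Nat.land m.succ m) := rfl
    have hb : Nat.xor m.succ (m.succ ^^^ 2 ^ v) = 2 ^ v := Nat.xor_xor_cancel_left _ _
    rw [hstep, applyEvaluated_eq, hv, hb]
    obtain ht | ⟨t, ht⟩ : Nat.land (N (2 ^ v)) (m.succ ^^^ 2 ^ v) = 0 ∨
        ∃ t : ℕ, Nat.land (N (2 ^ v)) (m.succ ^^^ 2 ^ v) = t.succ := by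
      cases Nat.land (N (2 ^ v)) (m.succ ^^^ 2 ^ v) <;> simp
    · rw [ht]
      refine (card_filter_testBit_le v fun u _ hu => ?_).trans (Nat.succ_le_succ (ih _))
      rw [Nat.testBit_xor, Nat.testBit_two_pow]
      by_cases huv : v = u <;> simp_all
    · obtain ⟨w, hw, hw'⟩ := exists_testBit_xor_land_pred t
      rw [ht]
      have hb' : Nat.xor t.succ (t.succ ^^^ 2 ^ w) = 2 ^ w := Nat.xor_xor_cancel_left _ _
      simp only [hw', hb']
      have hvw : (N (2 ^ v)).testBit w = true := by
        rw [← ht] at hw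
        exact (Bool.and_eq_true_iff.1 ((Nat.testBit_and _ _ _).symm.trans hw)).1
      refine (card_filter_testBit_le (if v ∈ s then v else w) fun u hu hc => ?_).trans
        (Nat.succ_le_succ (ih _))
      change _ ∨ ((m.succ ^^^ 2 ^ v) ^^^ 2 ^ w).testBit u = true
      rw [Nat.testBit_xor, Nat.testBit_xor, Nat.testBit_two_pow, Nat.testBit_two_pow]
      have : v ∈ s → v ≠ u → (N (2 ^ v)).testBit u = false := fun hv h => hs hv hu h
      grind

theorem not_testBit_of_branchOn {check : ℕ → Bool} {k : ℕ}
    (hcheck : ∀ c, check c = true → ∀ s : Finset ℕ,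
      (s : Set ℕ).Pairwise (fun v w => (N (2 ^ v)).testBit w = false) →
      (∀ v ∈ s, c.testBit v = true) → s.card ≠ k)
    (hs : (s : Set ℕ).Pairwise fun v w => (N (2 ^ v)).testBit w = false) (hk : s.card = k + 1)
    {fuel c r : ℕ} (h : branchOn N check fuel c r = true) (hc : ∀ v ∈ s, c.testBit v = true) :
    ∀ v ∈ s, r.testBit v = false := by
  induction fuel generalizing c r with
  | zero => exact absurd h Bool.false_ne_true
  | succ fuel ih =>
    obtain _ | m := r
    · simp
    obtain ⟨v, -, hv⟩ := exists_testBit_xor_land_pred m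
    have hstep : branchOn N check (fuel + 1) c (m + 1) = applyEvaluated
        (fun r' => applyEvaluated (fun b => applyEvaluated
            (fun d => and (check (Nat.xor d (Nat.land (N b) d))) (branchOn N check fuel d r'))
            (Nat.xor c b))
          (Nat.xor m.succ r')) (Nat.land m.succ m) := rfl
    have hb : Nat.xor m.succ (m.succ ^^^ 2 ^ v) = 2 ^ v := Nat.xor_xor_cancel_left _ _
    rw [hstep, applyEvaluated_eq, hv, hb, applyEvaluated_eq, applyEvaluated_eq,
      Bool.and_eq_true_iff] at h
    obtain ⟨h₁, h₂⟩ := h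
    change check ((c ^^^ 2 ^ v) ^^^ (N (2 ^ v) &&& (c ^^^ 2 ^ v))) = true at h₁
    change branchOn N check fuel (c ^^^ 2 ^ v) _ = true at h₂
    have hvs : v ∉ s := by
      intro hvs
      refine hcheck _ h₁ (s.erase v) (hs.mono (by simp)) (fun u hu => ?_)
        (by rw [Finset.card_erase_of_mem hvs, hk, Nat.add_sub_cancel])
      obtain ⟨huv, hu⟩ := Finset.mem_erase.1 hu
      simp [Nat.testBit_xor, Nat.testBit_and, hc u hu, hs hvs hu huv.symm,
        huv.symm]
    have hne : ∀ u ∈ s, v ≠ u := fun u hu h => hvs (h ▸ hu)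
    intro u hu
    have := ih h₂ (fun u hu => by
      simp [Nat.testBit_xor, hc u hu, hne u hu]) u hu
    simpa [Nat.testBit_xor, Nat.testBit_two_pow, hne u hu] using this

theorem card_ne_of_noIndepSet {fuel k c : ℕ} (h : noIndepSet N fuel k c = true)
    (hs : (s : Set ℕ).Pairwise fun v w => (N (2 ^ v)).testBit w = false)
    (hc : ∀ v ∈ s, c.testBit v = true) : s.card ≠ k := by
  induction k generalizing c s with
  | zero => exact absurd h Bool.false_ne_true
  | succ k ih =>
    intro hk
    have hr := not_testBit_of_branchOn (fun c h s hs hc => ih h hs hc) hs hk h hc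
    have := card_filter_le_greedyResidual hs k c
    rw [Finset.filter_true_of_mem hc, Finset.filter_false_of_mem fun v hv => by simp [hr v hv],
      Finset.card_empty] at this
    omega

end

/-- The adjacency rows of `baseGraph` as bit masks. -/
def adjRows : List ℕ := [
  0x008a20110162f000000, 0x0104063e82804040000, 0x0008609f01080148000, 0x0401fd4820008010000,
  0x0166803c80102001000, 0x020208828286e800000, 0x084340111b000900000, 0x044180481b202400800,
  0x18c320011e240000000, 0x00ae2d5004200020000, 0x02108a80e3204400000, 0x08127d0000028060080,
  0x04007e0202804044010, 0x011086022b211400000, 0x01070078a0008091000, 0x002610601e840020004,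
  0x007000041b220404008, 0x1440808e00182008a00, 0x02c1800000112201806, 0x0460fd0400102004000,
  0x100410000066f400044, 0x1006308e042c0040000, 0x008a201104900112480, 0x109ca20064200000060,
  0x0a410880d4800102001, 0x08100200640001e00b1, 0x084101001c080101423, 0x0060020444100104829,
  0x000409bc50400042000, 0x0401824864000110821, 0x0018c21061000308120, 0x02a00a40c2804220004,
  0x000000403b6084e0010, 0x0000402000900b12781, 0x0941060284910100001, 0x0010810021681409022,
  0x10041000049400124c5, 0x000801000018001b5e2, 0x000040000142fe08300, 0x02080880c010401a1c0,
  0x01080602001150181c0, 0x0060000500962806408, 0x01020402080fb800400, 0x0400710008481004432,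
  0x00149d2020000400145, 0x00a0014050400223026, 0x02810040200182b0016, 0x0a9000000003022409e,
  0x1600100000050404257, 0x168820010021000c012, 0x18100086001a000c288, 0x01a0044008011220424,
  0x1200020382814080a08, 0x00020100104ea803402, 0x1200008150400083a0a, 0x1100000108091081e28,
  0x0188001181000389808, 0x0100002080000e81b0d, 0x118400008424008184c, 0x08000001008608e2498,
  0x00380004004250441c8, 0x040002004000060cb71, 0x0600400101010b0c212, 0x084110201a040c00205,
  0x0401004900842812c00, 0x1801008220088098210, 0x000800002040d0f01d0, 0x000050ae00080c40301,
  0x0600788050400006012, 0x0104053c08081040420, 0x09160030800200a1088, 0x0428804800407000940,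
  0x00204d7001000b20100]

/-- The rows of `adjRows` packed into one number with 73 bits per row. -/
def adjTable : ℕ := adjRows.foldr (fun r t => r + 2 ^ 73 * t) 0

/-- `nbrs (2 ^ v)` has the neighbors of `v` in its 73 lowest bits. -/
def nbrs (b : ℕ) : ℕ := Nat.div adjTable (Nat.pow b 73)

set_option maxRecDepth 100000 in
theorem noIndepSet_nbrs : noIndepSet nbrs 73 15 (2 ^ 73 - 1) = true := by
  decide +kernel

set_option maxRecDepth 100000 in
theorem testBit_nbrs_comm : ∀ i j : Fin 73,
    (nbrs (2 ^ i.val)).testBit j.val = (nbrs (2 ^ j.val)).testBit i.val := by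
  decide +kernel

set_option maxRecDepth 100000 in
theorem nbrs_land_nbrs_eq_zero : ∀ i j : Fin 73, (nbrs (2 ^ i.val)).testBit j.val = true →
    nbrs (2 ^ i.val) % 2 ^ 73 &&& nbrs (2 ^ j.val) = 0 := by
  decide +kernel

/-- A triangle-free graph on 73 vertices without independent sets of size 15. -/
def baseGraph : SimpleGraph (Fin 73) :=
  SimpleGraph.fromRel fun i j => (nbrs (2 ^ i.val)).testBit j.val = true

theorem baseGraph_adj {i j : Fin 73} :
    baseGraph.Adj i j ↔ i ≠ j ∧ (nbrs (2 ^ i.val)).testBit j.val = true := by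
  rw [baseGraph, SimpleGraph.fromRel_adj, testBit_nbrs_comm j i, or_self]

theorem cliqueFree_baseGraph : baseGraph.CliqueFree 3 := by
  intro s hs
  obtain ⟨a, b, c, hab, hac, hbc, -⟩ := SimpleGraph.is3Clique_iff.1 hs
  rw [baseGraph_adj] at hab hac hbc
  have := congrArg (fun n => n.testBit c.val) (nbrs_land_nbrs_eq_zero a b hab.2)
  simp only [Nat.testBit_and, Nat.testBit_mod_two_pow, hac.2, hbc.2, c.isLt, Nat.zero_testBit,
    decide_true, Bool.and_self, Bool.true_eq_false] at this

theorem cliqueFree_compl_baseGraph : baseGraphᶜ.CliqueFree 15 := by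
  intro s hs
  refine card_ne_of_noIndepSet noIndepSet_nbrs (s := s.map Fin.valEmbedding) ?_ ?_
    ((Finset.card_map _).trans hs.card_eq)
  · rw [Finset.coe_map]
    rintro _ ⟨i, hi, rfl⟩ _ ⟨j, hj, rfl⟩ hij
    have hij' : i ≠ j := fun h => hij (h ▸ rfl)
    have := ((SimpleGraph.compl_adj _ _ _).1 (hs.isClique hi hj hij')).2
    simpa [baseGraph_adj, hij'] using this
  · intro v hv
    obtain ⟨i, -, rfl⟩ := Finset.mem_map.1 hv
    rw [Nat.testBit_two_pow_sub_one]
    exact decide_eq_true i.isLt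

end RamseyLowerBound

theorem ramsey_lower_bound_R_5_16 :
    ∃ G : SimpleGraph (Fin 292), G.CliqueFree 5 ∧ Gᶜ.CliqueFree 16 := by
  let e : Fin 292 ≃ Fin 73 × Fin 4 := (finProdFinEquiv (m := 73) (n := 4)).symm
  let H := RamseyLowerBound.fourfoldGraph RamseyLowerBound.baseGraph
  let f := (SimpleGraph.Iso.comap e H).toEmbedding
  exact ⟨H.comap e,
    (RamseyLowerBound.fourfoldGraph.cliqueFree_five
      RamseyLowerBound.cliqueFree_baseGraph).comap ⟨f.toCopy⟩,
    (RamseyLowerBound.fourfoldGraph.compl_cliqueFree_succ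
      RamseyLowerBound.cliqueFree_compl_baseGraph).comap
        ⟨(SimpleGraph.Embedding.complEquiv f).toCopy⟩⟩
end
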